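/- arXiv:2103.02135 — 4 statements merged into one kernel-verified Lean document; each statement's English description precedes it below -/
import Mathlib

section
/- For all non-negative integers n, the number of partitions of 3n+2 with designated summands is divisible by 3. (A partition with designated summands is a partition in which exactly one part among each group of equal parts is tagged/designated.) -/
/-- A multiset of natural numbers represents a partition if all parts are positive. -/
def IsPartitionM (m : Multiset ℕ) : Prop := ∀ i ∈ m, 0 < i

/-- A partition all of whose parts are even (and positive). -/
def IsEvenPartition (m : Multiset ℕ) : Prop := IsPartitionM m ∧ ∀ i ∈ m, Even i

/-- A staircase partition: parts k, k-1, ..., 2, 1 (possibly empty). -/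
def IsStaircase (m : Multiset ℕ) : Prop := ∃ k : ℕ, m = (Multiset.range k).map (· + 1)

/-- An odd staircase: parts 2k-1, 2k-3, ..., 3, 1 (possibly empty); its size is k². -/
def IsOddStaircase (m : Multiset ℕ) : Prop := ∃ k : ℕ, m = (Multiset.range k).map (fun i => 2 * i + 1)

/-- A partition into distinct odd parts. -/
def IsDistinctOdd (m : Multiset ℕ) : Prop := m.Nodup ∧ ∀ i ∈ m, Odd i

/-- A partition whose odd parts are distinct (even parts unrestricted). -/
def IsPOD (m : Multiset ℕ) : Prop := IsPartitionM m ∧ ∀ i ∈ m, Odd i → m.count i ≤ 1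

/-- A partition into distinct parts, all divisible by 3. -/
def IsDistinctMul3 (m : Multiset ℕ) : Prop := IsPartitionM m ∧ m.Nodup ∧ ∀ i ∈ m, 3 ∣ i

/-- An overpartition: a partition together with a set of overlined part sizes,
each of which must occur in the partition. -/
def IsOverpartition (x : Multiset ℕ × Finset ℕ) : Prop :=
  IsPartitionM x.1 ∧ ∀ s ∈ x.2, s ∈ x.1

/-- A partition with designated summands: a partition together with, for each part size
occurring with multiplicity `c`, a choice of designated occurrence in `{1, ..., c}`
(and `0` for non-occurring sizes). -/
def IsDesignated (x : Multiset ℕ × (ℕ → ℕ)) : Prop :=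
  IsPartitionM x.1 ∧ ∀ s : ℕ,
    (0 < x.1.count s → 1 ≤ x.2 s ∧ x.2 s ≤ x.1.count s) ∧ (x.1.count s = 0 → x.2 s = 0)

open Finset PowerSeries

section Gauss

variable {R : Type*} [CommRing R]

theorem sum_range_telescope_of_qRatio {q : R} {a : ℕ → R}
    (ha : ∀ s, a (s + 1) * (1 - q ^ (s + 1)) = a s * (1 + q ^ s)) (n m : ℕ) :
    ∑ s ∈ range m, (-1) ^ s * q ^ (s * n) * a s * (q ^ s * (1 - q ^ n) - (1 + q ^ n)) =
      (-1) ^ m * q ^ (m * n) * a m * (1 - q ^ m) := by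
  induction m with
  | zero => simp
  | succ m ih =>
    rw [sum_range_succ, ih]
    linear_combination (-1) ^ m * q ^ (m * n) * q ^ n * ha m

theorem mul_mul_one_add_pow_eq_two [IsDomain R] {q : R} {a P : ℕ → R}
    (ha0 : a 0 = 1) (ha : ∀ s, a (s + 1) * (1 - q ^ (s + 1)) = a s * (1 + q ^ s))
    (hP0 : P 0 = 1) (hP : ∀ n, P (n + 1) * (1 + q ^ (n + 1)) = P n * (1 - q ^ (n + 1)))
    (hq : ∀ n, 1 - q ^ (n + 1) ≠ 0) (n : ℕ) :
    a n * P n * (1 + q ^ n) = 2 := by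
  induction n with
  | zero => rw [ha0, hP0]; norm_num
  | succ n ih =>
    apply mul_right_cancel₀ (hq n)
    linear_combination P (n + 1) * (1 + q ^ (n + 1)) * ha n + a n * (1 + q ^ n) * hP n +
      (1 - q ^ (n + 1)) * ih

/-- A finite form of Gauss's identity `∏ (1 - q ^ n) / (1 + q ^ n) = ∑ (-1) ^ k * q ^ (k ^ 2)`. -/
theorem finite_gauss_identity [IsDomain R] {q : R} {a P : ℕ → R}
    (ha0 : a 0 = 1) (ha : ∀ s, a (s + 1) * (1 - q ^ (s + 1)) = a s * (1 + q ^ s))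
    (hP0 : P 0 = 1) (hP : ∀ n, P (n + 1) * (1 + q ^ (n + 1)) = P n * (1 - q ^ (n + 1)))
    (hq : ∀ n, 1 - q ^ (n + 1) ≠ 0) (hq' : ∀ n, 1 + q ^ (n + 1) ≠ 0) (n : ℕ) :
    ∑ s ∈ range (n + 1), (-1) ^ s * q ^ (s * (n + 1)) * a s * P n =
      1 + ∑ k ∈ range n, 2 * (-1) ^ (k + 1) * q ^ ((k + 1) ^ 2) := by
  induction n with
  | zero => simp [ha0, hP0]
  | succ n ih =>
    apply mul_right_cancel₀ (hq' n)
    have htel := sum_range_telescope_of_qRatio ha (n + 1) (n + 1)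
    have hnorm := mul_mul_one_add_pow_eq_two ha0 ha hP0 hP hq (n + 1)
    rw [sum_range_succ _ n, ← add_assoc, ← ih, sum_range_succ _ (n + 1)]
    have hdiff : (∑ s ∈ range (n + 1), (-1) ^ s * q ^ (s * (n + 1 + 1)) * a s * P (n + 1)) *
          (1 + q ^ (n + 1)) =
        (∑ s ∈ range (n + 1), (-1) ^ s * q ^ (s * (n + 1)) * a s * P n) * (1 + q ^ (n + 1)) +
        P n * ∑ s ∈ range (n + 1), (-1) ^ s * q ^ (s * (n + 1)) * a s *
          (q ^ s * (1 - q ^ (n + 1)) - (1 + q ^ (n + 1))) := by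
      rw [sum_mul, sum_mul, mul_sum, ← sum_add_distrib]
      refine sum_congr rfl fun s _ ↦ ?_
      linear_combination (-1) ^ s * q ^ (s * (n + 1 + 1)) * a s * hP n
    rw [add_mul, hdiff, htel]
    linear_combination
      (-1) ^ (n + 1) * q ^ ((n + 1) ^ 2) * (1 + q ^ (n + 1)) * hnorm
      - (-1) ^ (n + 1) * q ^ ((n + 1) ^ 2) * a (n + 1) * hP n

end Gauss

section PowerSeries

/-- The partial products of `∏ (1 - X ^ i) / (1 + X ^ i)`. -/
noncomputable def phiProd (K : Type*) [Field K] (n : ℕ) : K⟦X⟧ :=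
  ∏ i ∈ range n, (1 - X ^ (i + 1)) * (1 + X ^ (i + 1))⁻¹

variable {K : Type*} [Field K]

theorem one_sub_X_pow_succ_mul_inv (n : ℕ) :
    (1 - X ^ (n + 1) : K⟦X⟧) * (1 - X ^ (n + 1))⁻¹ = 1 :=
  PowerSeries.mul_inv_cancel _ (by simp)

theorem one_add_X_pow_succ_mul_inv (n : ℕ) :
    (1 + X ^ (n + 1) : K⟦X⟧) * (1 + X ^ (n + 1))⁻¹ = 1 :=
  PowerSeries.mul_inv_cancel _ (by simp)

theorem coeff_phiProd_eq_zero {n m : ℕ} (hmn : m ≤ n) (hm : ∀ k, m ≠ k ^ 2) :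
    coeff m (phiProd K n) = 0 := by
  let a : ℕ → K⟦X⟧ := fun n ↦ ∏ i ∈ range n, (1 + X ^ i) * (1 - X ^ (i + 1))⁻¹
  have key := finite_gauss_identity (q := (X : K⟦X⟧)) (a := a) (P := phiProd K) (by simp [a])
    (fun s ↦ by
      simp only [a]
      rw [prod_range_succ]
      linear_combination (∏ i ∈ range s, (1 + X ^ i) * (1 - (X : K⟦X⟧) ^ (i + 1))⁻¹) *
        (1 + X ^ s) * one_sub_X_pow_succ_mul_inv (K := K) s)
    (by simp [phiProd])
    (fun n ↦ by
      rw [phiProd, prod_range_succ, ← phiProd]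
      linear_combination phiProd K n * (1 - X ^ (n + 1)) * one_add_X_pow_succ_mul_inv (K := K) n)
    (fun n ↦ left_ne_zero_of_mul_eq_one (one_sub_X_pow_succ_mul_inv n))
    (fun n ↦ left_ne_zero_of_mul_eq_one (one_add_X_pow_succ_mul_inv n)) n
  have hm0 : m ≠ 0 := by simpa using hm 0
  have hcoeff := congrArg (coeff m) key
  have hright : coeff m (1 + ∑ k ∈ range n, 2 * (-1) ^ (k + 1) * X ^ ((k + 1) ^ 2) : K⟦X⟧) = 0 := by
    rw [map_add, map_sum, coeff_one, if_neg hm0, zero_add]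
    refine sum_eq_zero fun k _ ↦ ?_
    have hc : (2 * (-1) ^ (k + 1) : K⟦X⟧) = C (2 * (-1) ^ (k + 1)) := by
      simp [map_ofNat (C : K →+* K⟦X⟧) 2]
    rw [hc, coeff_C_mul, coeff_X_pow, if_neg (hm (k + 1)), mul_zero]
  rw [hright, sum_range_succ', map_add, map_sum, sum_eq_zero, zero_add] at hcoeff
  · simpa [a] using hcoeff
  · intro s _
    rw [show (-1) ^ (s + 1) * X ^ ((s + 1) * (n + 1)) * a (s + 1) * phiProd K n =
      X ^ ((s + 1) * (n + 1)) * ((-1) ^ (s + 1) * a (s + 1) * phiProd K n) by ring]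
    rw [coeff_X_pow_mul', if_neg]
    nlinarith

theorem constantCoeff_phiProd (n : ℕ) : constantCoeff (phiProd K n) = 1 := by
  simp [phiProd, map_prod]

theorem coeff_pow_char_eq_zero {p : ℕ} [CharP K p] (f : K⟦X⟧) {m : ℕ} (hm : ¬ p ∣ m) :
    coeff m (f ^ p) = 0 := by
  obtain ⟨k, rfl⟩ := Nat.exists_eq_add_one_of_ne_zero (n := m) (by rintro rfl; simp at hm)
  have hchar : (p : K⟦X⟧) = 0 := by
    rw [← map_natCast (C : K →+* K⟦X⟧) p, CharP.cast_eq_zero, map_zero]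
  have hd : derivative K (f ^ p) = 0 := by
    rw [Derivation.leibniz_pow, ← Nat.cast_smul_eq_nsmul K⟦X⟧, hchar, zero_smul]
  have hcoeff := congrArg (coeff k) hd
  rw [coeff_derivative, map_zero] at hcoeff
  refine (mul_eq_zero.mp hcoeff).resolve_right ?_
  rwa [← Nat.cast_succ, CharP.cast_eq_zero_iff K p]

theorem coeff_eq_zero_of_mul_phiProd_sq {F : Type*} [Field F] [CharP F 3] {f : F⟦X⟧} {N n : ℕ}
    (hf : f * phiProd F N ^ 2 = 1) (hN : 3 * n + 2 ≤ N) : coeff (3 * n + 2) f = 0 := by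
  have hinv := PowerSeries.mul_inv_cancel (phiProd F N) (by simp [constantCoeff_phiProd])
  have hfac : f = phiProd F N * (phiProd F N)⁻¹ ^ 3 := by
    set Q := (phiProd F N)⁻¹
    set P := phiProd F N
    calc f = f * (P * Q) ^ 2 := by rw [hinv]; ring
      _ = (f * P ^ 2) * Q ^ 2 := by ring
      _ = (P * Q) * Q ^ 2 := by rw [hf, hinv]
      _ = P * Q ^ 3 := by ring
  rw [hfac, coeff_mul]
  refine sum_eq_zero fun x hx ↦ ?_
  rw [HasAntidiagonal.mem_antidiagonal] at hx
  by_cases h3 : 3 ∣ x.2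
  · rw [coeff_phiProd_eq_zero (by omega), zero_mul]
    intro k hk
    have hmod : k ^ 2 % 3 = 2 := by omega
    have : k % 3 = 0 ∨ k % 3 = 1 ∨ k % 3 = 2 := by omega
    rcases this with h | h | h <;> simp [Nat.pow_mod, h] at hmod
  · rw [coeff_pow_char_eq_zero _ h3, mul_zero]

open scoped PowerSeries.WithPiTopology in
theorem one_add_tsum_mul_sq [TopologicalSpace K] [IsTopologicalRing K] [T2Space K] (i : ℕ) :
    (1 + ∑' j : ℕ, ((j + 1 : ℕ) : K) • (X : K⟦X⟧) ^ ((i + 1) * (j + 1))) *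
      (1 - X ^ (i + 1)) ^ 2 = 1 - X ^ (i + 1) + (X ^ (i + 1)) ^ 2 := by
  set y : K⟦X⟧ := X ^ (i + 1) with hy
  have hy0 : constantCoeff y = 0 := by simp [hy]
  have hsum := Nat.Partition.summable_genFun_term (fun _ c ↦ (c : K)) i
  have hgeom := PowerSeries.WithPiTopology.summable_pow_of_constantCoeff_eq_zero hy0
  have hgeom1 := PowerSeries.WithPiTopology.tsum_pow_mul_one_sub_of_constantCoeff_eq_zero hy0
  simp only [pow_mul, ← hy] at hsum ⊢
  set B := ∑' j : ℕ, ((j + 1 : ℕ) : K) • y ^ (j + 1) with hB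
  have hshift : B = y * ∑' j : ℕ, y ^ j + y * B := by
    have hy1 : Summable fun j : ℕ ↦ y * y ^ j := hgeom.mul_left y
    have hy2 : Summable fun j : ℕ ↦ y * (((j + 1 : ℕ) : K) • y ^ (j + 1)) := hsum.mul_left y
    have hy3 : y * B = ∑' j : ℕ, (j : K) • y ^ (j + 1) := by
      rw [tsum_eq_zero_add' (by simpa [pow_succ', mul_smul_comm] using hy2), hB, ← hsum.tsum_mul_left]
      simp [pow_succ']
    have hy4 : Summable fun j : ℕ ↦ (j : K) • y ^ (j + 1) := by
      rw [← summable_nat_add_iff 1]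
      simpa [pow_succ', mul_smul_comm] using hy2
    rw [hy3, ← hgeom.tsum_mul_left, ← hy1.tsum_add hy4, hB]
    refine tsum_congr fun j ↦ ?_
    rw [Nat.cast_succ, add_smul, one_smul, add_comm, pow_succ']
  linear_combination (1 - y) * hshift + y * hgeom1

open scoped PowerSeries.WithPiTopology in
theorem coeff_genFun_eq_zero (n : ℕ) :
    coeff (3 * n + 2) (Nat.Partition.genFun fun _ c ↦ (c : ZMod 3)) = 0 := by
  have : Fact (Nat.Prime 3) := ⟨Nat.prime_three⟩
  let _ : TopologicalSpace (ZMod 3) := ⊥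
  have _ : DiscreteTopology (ZMod 3) := ⟨rfl⟩
  have hprod := (Nat.Partition.hasProd_genFun fun _ c ↦ (c : ZMod 3)).tendsto_prod_nat
  rw [PowerSeries.WithPiTopology.tendsto_iff_coeff_tendsto] at hprod
  have hev := hprod (3 * n + 2)
  rw [nhds_discrete, Filter.tendsto_pure] at hev
  obtain ⟨N, hN, hle⟩ := (hev.and (Filter.eventually_ge_atTop (3 * n + 2))).exists
  rw [← hN]
  refine coeff_eq_zero_of_mul_phiProd_sq ?_ hle
  rw [phiProd, ← prod_pow, ← prod_mul_distrib]
  refine prod_eq_one fun i _ ↦ ?_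
  have h3 : (3 : (ZMod 3)⟦X⟧) = 0 := by
    rw [← map_ofNat (C : ZMod 3 →+* (ZMod 3)⟦X⟧) 3, show (OfNat.ofNat 3 : ZMod 3) = 0 from rfl,
      map_zero]
  have hinv := one_add_X_pow_succ_mul_inv (K := ZMod 3) i
  have hterm := one_add_tsum_mul_sq (K := ZMod 3) i
  set y : (ZMod 3)⟦X⟧ := X ^ (i + 1)
  set Q := (1 + y)⁻¹
  linear_combination Q ^ 2 * hterm - Q ^ 2 * y * h3 + ((1 + y) * Q + 1) * hinv

end PowerSeries

section Counting

/-- The ways of designating one copy of each part of `m`. -/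
def designationEquiv (m : Multiset ℕ) :
    {d : ℕ → ℕ // ∀ s, (0 < m.count s → 1 ≤ d s ∧ d s ≤ m.count s) ∧ (m.count s = 0 → d s = 0)} ≃
      ((i : m.toFinset) → Fin (m.count (i : ℕ))) where
  toFun d i := ⟨d.1 i - 1, by
    have hi : 0 < m.count (i : ℕ) := Multiset.count_pos.mpr (Multiset.mem_toFinset.mp i.2)
    have := (d.2 i).1 hi
    omega⟩
  invFun g := ⟨fun s ↦ if h : s ∈ m.toFinset then g ⟨s, h⟩ + 1 else 0, fun s ↦ by
    by_cases h : s ∈ m.toFinset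
    · have hs : 0 < m.count s := Multiset.count_pos.mpr (Multiset.mem_toFinset.mp h)
      have := (g ⟨s, h⟩).2
      simp only [h, dite_true] at this ⊢
      omega
    · have hs : m.count s = 0 := Multiset.count_eq_zero.mpr (by simpa using h)
      simp [h, hs]⟩
  left_inv d := by
    ext s
    by_cases h : s ∈ m.toFinset
    · have hs : 0 < m.count s := Multiset.count_pos.mpr (Multiset.mem_toFinset.mp h)
      have := (d.2 s).1 hs
      simp only [h, dite_true]
      omega
    · have hs : m.count s = 0 := Multiset.count_eq_zero.mpr (by simpa using h)
      simp [h, (d.2 s).2 hs]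
  right_inv g := by
    ext i
    simp

/-- Partitions with designated summands, fibred over their underlying partitions. -/
def designatedEquivSigma (n : ℕ) :
    {x : Multiset ℕ × (ℕ → ℕ) // IsDesignated x ∧ x.1.sum = n} ≃
      (p : n.Partition) × {d : ℕ → ℕ // ∀ s, (0 < p.parts.count s →
        1 ≤ d s ∧ d s ≤ p.parts.count s) ∧ (p.parts.count s = 0 → d s = 0)} where
  toFun x := ⟨⟨x.1.1, fun {i} hi ↦ x.2.1.1 i hi, x.2.2⟩, ⟨x.1.2, x.2.1.2⟩⟩
  invFun y := ⟨(y.1.parts, y.2.1), ⟨fun _ hi ↦ y.1.parts_pos hi, y.2.2⟩, y.1.parts_sum⟩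
  left_inv _ := rfl
  right_inv _ := rfl

theorem natCard_designated (n : ℕ) :
    Nat.card {x : Multiset ℕ × (ℕ → ℕ) // IsDesignated x ∧ x.1.sum = n} =
      ∑ p : n.Partition, ∏ i ∈ p.parts.toFinset, p.parts.count i := by
  rw [Nat.card_congr ((designatedEquivSigma n).trans
    (Equiv.sigmaCongrRight fun p ↦ designationEquiv p.parts)), Nat.card_eq_fintype_card,
    Fintype.card_sigma]
  refine sum_congr rfl fun p _ ↦ ?_
  rw [Fintype.card_pi, ← prod_coe_sort p.parts.toFinset]
  simp

end Counting

theorem pd_congruence (n : ℕ) :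
    3 ∣ Nat.card {x : Multiset ℕ × (ℕ → ℕ) //
      IsDesignated x ∧ x.1.sum = 3 * n + 2} := by
  rw [natCard_designated, ← CharP.cast_eq_zero_iff (ZMod 3) 3, ← coeff_genFun_eq_zero n,
    Nat.Partition.coeff_genFun]
  push_cast
  refine sum_congr rfl fun p _ ↦ ?_
  simp [Finsupp.prod]
end

section
/- For all non-negative integers n, the number of 2-color partitions of 3n+2 with colors r and b, where color b may only be used on even parts, is divisible by 3. -/
open Finset PowerSeries

/-- A finite form of Gauss's square identity for `∏ (1 - q ^ i) / (1 + q ^ i)`. -/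
theorem prod_one_add_mul_sum_sq {R : Type*} [CommRing R] (q : R) (n : ℕ) :
    (∏ i ∈ range n, (1 + q ^ (i + 1))) * (1 + 2 * ∑ j ∈ range n, (-1) ^ (j + 1) * q ^ (j + 1) ^ 2) =
      ∑ s ∈ range (n + 1), (-1) ^ s * (∏ i ∈ range s, (1 + q ^ i)) *
        (∏ i ∈ Ico s n, (1 - q ^ (i + 1))) * q ^ (s * (n + 1)) := by
  induction n with
  | zero => simp
  | succ n ih =>
    let h : ℕ → R := fun s ↦ (-1) ^ s * (∏ i ∈ range s, (1 + q ^ i)) *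
      (∏ i ∈ Ico s (n + 1), (1 - q ^ i)) * q ^ (s * (n + 1))
    have step : ∀ s ∈ range (n + 1), (-1) ^ s * (∏ i ∈ range s, (1 + q ^ i)) *
        (∏ i ∈ Ico s (n + 1), (1 - q ^ (i + 1))) * q ^ (s * (n + 1 + 1)) =
        (1 + q ^ (n + 1)) * ((-1) ^ s * (∏ i ∈ range s, (1 + q ^ i)) *
          (∏ i ∈ Ico s n, (1 - q ^ (i + 1))) * q ^ (s * (n + 1))) + (h (s + 1) - h s) := by
      intro s hs
      have hs : s ≤ n := by simpa [Nat.lt_succ_iff] using hs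
      simp only [h]
      rw [prod_Ico_succ_top hs, prod_eq_prod_Ico_succ_bot (Nat.lt_succ_of_le hs) fun i ↦ 1 - q ^ i,
        ← prod_Ico_add' (fun i ↦ 1 - q ^ i) s n 1, prod_range_succ]
      ring
    have two : ∏ i ∈ range (n + 1), (1 + q ^ i) = 2 * ∏ i ∈ range n, (1 + q ^ (i + 1)) := by
      rw [prod_range_succ', pow_zero, one_add_one_eq_two, mul_comm]
    have h_zero : h 0 = 0 := by simp [h, prod_range_succ']
    rw [sum_range_succ _ (n + 1), sum_congr rfl step, sum_add_distrib, sum_range_sub, ← mul_sum,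
      ← ih, prod_range_succ, sum_range_succ, h_zero]
    simp only [h, two, Ico_self, prod_empty]
    ring

/-- The generating function of partitions whose parts are at most `N` and satisfy `p`
is the inverse of a finite product. -/
theorem card_restricted_mul_prod_eq_one (R : Type*) [CommRing R] [NoZeroDivisors R]
    (p : ℕ → Prop) [DecidablePred p] (N : ℕ) :
    (PowerSeries.mk fun n ↦ (#(Nat.Partition.restricted n fun i ↦ i ≤ N ∧ p i) : R)) *
      ∏ i ∈ range N, (if p (i + 1) then 1 - X ^ (i + 1) else 1) = 1 := by
  let _ : TopologicalSpace R := ⊥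
  have _ : DiscreteTopology R := ⟨rfl⟩
  have h := Nat.Partition.hasProd_powerSeriesMk_card_restricted R fun i ↦ i ≤ N ∧ p i
  open scoped PowerSeries.WithPiTopology in
  rw [h.unique (hasProd_prod_of_ne_finset_one (s := range N) (by grind)), ← prod_mul_distrib]
  refine prod_eq_one fun i hi ↦ ?_
  have hi : i + 1 ≤ N := by simpa using hi
  by_cases hp : p (i + 1)
  · simp only [hi, hp, and_self, if_true, pow_mul]
    exact WithPiTopology.tsum_pow_mul_one_sub_of_constantCoeff_eq_zero (by simp)
  · simp [hp]

theorem prod_even_one_sub_X_pow (R : Type*) [CommRing R] (N : ℕ) :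
    ∏ i ∈ range (2 * N), (if Even (i + 1) then 1 - (X : R⟦X⟧) ^ (i + 1) else 1) =
      (∏ i ∈ range N, (1 - X ^ (i + 1))) * ∏ i ∈ range N, (1 + X ^ (i + 1)) := by
  rw [← prod_mul_distrib]
  induction N with
  | zero => simp
  | succ N ih =>
    rw [Nat.mul_succ, prod_range_succ, prod_range_succ, ih, prod_range_succ,
      if_neg (by simp), if_pos (by simp [parity_simps])]
    ring

theorem coeff_pow_char_eq_zero_s1 {R : Type*} [CommRing R] (p : ℕ) [ExpChar R p] (F : R⟦X⟧) {m : ℕ}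
    (hm : ¬ p ∣ m) : coeff m (F ^ p) = 0 := by
  have hp : p ≠ 0 := expChar_ne_zero R p
  rw [← MvPowerSeries.map_frobenius_expand p hp (f := F)]
  change coeff m (PowerSeries.map (frobenius R p) (expand p hp F)) = 0
  rw [coeff_map, coeff_expand_of_not_dvd _ _ _ hm, map_zero]

/-- The partial sums of `∑ (-1) ^ j * X ^ j ^ 2` have no terms of degree `2` modulo `3`. -/
theorem coeff_sum_sq_eq_zero {R : Type*} [CommRing R] {m : ℕ} (hm : m % 3 = 2) (N : ℕ) :
    coeff m (1 + 2 * ∑ j ∈ range N, (-1) ^ (j + 1) * (X : R⟦X⟧) ^ (j + 1) ^ 2) = 0 := by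
  have hsq (k : ℕ) : m ≠ k ^ 2 := by
    rintro rfl
    have : k % 3 < 3 := Nat.mod_lt _ (by norm_num)
    rw [Nat.pow_mod] at hm
    interval_cases k % 3 <;> simp at hm
  have hc (k : ℕ) : (-1 : R⟦X⟧) ^ k = C ((-1) ^ k) := by simp
  have two : (2 : R⟦X⟧) = C 2 := (map_ofNat C 2).symm
  rw [map_add, two, coeff_C_mul, map_sum, sum_eq_zero, mul_zero, add_zero, coeff_one, if_neg]
  · simpa using hsq 0
  · intro j _
    rw [hc, coeff_C_mul, coeff_X_pow, if_neg (hsq _), mul_zero]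

/-- Pairs of a partition and a partition into even parts are counted by a product of generating
functions. -/
theorem natCard_partition_evenPartition_eq_coeff (R : Type*) [CommSemiring R] (N : ℕ) :
    (Nat.card {x : Multiset ℕ × Multiset ℕ //
      IsPartitionM x.1 ∧ IsEvenPartition x.2 ∧ x.1.sum + x.2.sum = N} : R) =
    coeff N ((PowerSeries.mk fun n ↦
        (#(Nat.Partition.restricted n fun i ↦ i ≤ N ∧ True) : R)) *
        PowerSeries.mk fun n ↦ (#(Nat.Partition.restricted n fun i ↦ i ≤ 2 * N ∧ Even i) : R)) := by
  let e : {x : Multiset ℕ × Multiset ℕ //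
      IsPartitionM x.1 ∧ IsEvenPartition x.2 ∧ x.1.sum + x.2.sum = N} ≃
      Σ ij : antidiagonal N, Nat.Partition.restricted ij.1.1 (fun i ↦ i ≤ N ∧ True) ×
        Nat.Partition.restricted ij.1.2 (fun i ↦ i ≤ 2 * N ∧ Even i) :=
    { toFun x := ⟨⟨(x.1.1.sum, x.1.2.sum), by simpa using x.2.2.2⟩,
        ⟨⟨x.1.1, @x.2.1, rfl⟩, by
          simp only [Nat.Partition.restricted, mem_filter, mem_univ, true_and, and_true]
          intro i hi
          have := Multiset.le_sum_of_mem hi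
          have := x.2.2.2
          omega⟩,
        ⟨⟨x.1.2, @x.2.2.1.1, rfl⟩, by
          simp only [Nat.Partition.restricted, mem_filter, mem_univ, true_and]
          intro i hi
          have := Multiset.le_sum_of_mem hi
          have := x.2.2.2
          exact ⟨by omega, x.2.2.1.2 i hi⟩⟩⟩
      invFun y := ⟨(y.2.1.1.parts, y.2.2.1.parts), fun i hi ↦ y.2.1.1.parts_pos hi,
        ⟨fun i hi ↦ y.2.2.1.parts_pos hi, fun i hi ↦ ((mem_filter.1 y.2.2.2).2 i hi).2⟩, by
          simpa only [Nat.Partition.parts_sum] using mem_antidiagonal.1 y.1.2⟩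
      left_inv x := rfl
      right_inv := by
        rintro ⟨⟨⟨i, j⟩, hij⟩, ⟨⟨p, hp, hi⟩, hp'⟩, ⟨⟨q, hq, hj⟩, hq'⟩⟩
        dsimp only at hi hj
        subst hi hj
        rfl }
  rw [Nat.card_congr e, Nat.card_sigma, coeff_mul]
  simp only [Nat.card_eq_fintype_card, Fintype.card_prod, Fintype.card_coe, coeff_mk]
  rw [sum_coe_sort (antidiagonal N) fun ij ↦ #(Nat.Partition.restricted ij.1 fun i ↦ i ≤ N ∧ True) *
    #(Nat.Partition.restricted ij.2 fun i ↦ i ≤ 2 * N ∧ Even i)]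
  push_cast
  rfl

theorem a_congruence (n : ℕ) :
    3 ∣ Nat.card {x : Multiset ℕ × Multiset ℕ //
      IsPartitionM x.1 ∧ IsEvenPartition x.2 ∧ x.1.sum + x.2.sum = 3 * n + 2} := by
  rw [← CharP.cast_eq_zero_iff (ZMod 3), natCard_partition_evenPartition_eq_coeff]
  generalize hN : 3 * n + 2 = N
  have hP := card_restricted_mul_prod_eq_one (ZMod 3) (fun _ ↦ True) N
  have hE := card_restricted_mul_prod_eq_one (ZMod 3) Even (2 * N)
  rw [prod_even_one_sub_X_pow] at hE
  simp only [if_true] at hP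
  have hG := prod_one_add_mul_sum_sq (X : (ZMod 3)⟦X⟧) N
  rw [sum_range_succ' _ N, Nat.Ico_zero_eq_range] at hG
  obtain ⟨T, hT⟩ : (X : (ZMod 3)⟦X⟧) ^ (N + 1) ∣ ∑ s ∈ range N, (-1) ^ (s + 1) *
      (∏ i ∈ range (s + 1), (1 + X ^ i)) * (∏ i ∈ Ico (s + 1) N, (1 - X ^ (i + 1))) *
        X ^ ((s + 1) * (N + 1)) :=
    dvd_sum fun s _ ↦ Dvd.dvd.mul_left (pow_dvd_pow _ (Nat.le_mul_of_pos_left _ s.succ_pos)) _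
  rw [hT] at hG
  simp only [pow_zero, range_zero, prod_empty, one_mul, zero_mul, mul_one] at hG
  generalize (PowerSeries.mk fun k ↦
    (#(Nat.Partition.restricted k fun i ↦ i ≤ N ∧ True) : ZMod 3)) = F at *
  generalize (PowerSeries.mk fun k ↦
    (#(Nat.Partition.restricted k fun i ↦ i ≤ 2 * N ∧ Even i) : ZMod 3)) = E at *
  generalize hS : 1 + 2 * ∑ j ∈ range N, (-1) ^ (j + 1) * (X : (ZMod 3)⟦X⟧) ^ (j + 1) ^ 2 = S at *
  generalize ∏ i ∈ range N, (1 - (X : (ZMod 3)⟦X⟧) ^ (i + 1)) = A at *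
  generalize ∏ i ∈ range N, (1 + (X : (ZMod 3)⟦X⟧) ^ (i + 1)) = D at *
  have key : F * E = S * F ^ 3 - X ^ (N + 1) * (T * E * F ^ 2) := by
    linear_combination S * F ^ 3 * hE - F ^ 3 * E * A * hG -
      (X ^ (N + 1) * T * E * F ^ 2 + F * E * (F * A + 1)) * hP
  rw [key, map_sub, coeff_X_pow_mul', if_neg (by omega), sub_zero, coeff_mul]
  refine sum_eq_zero fun ij hij ↦ ?_
  rw [HasAntidiagonal.mem_antidiagonal] at hij
  by_cases h3 : 3 ∣ ij.2
  · rw [← hS, coeff_sum_sq_eq_zero (by omega), zero_mul]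
  · rw [coeff_pow_char_eq_zero_s1 3 _ h3, mul_zero]
end

section
/- There is a size-preserving bijection between partitions of n with designated summands and quintuples (λ¹, λ², λ³, λ⁴, λ⁵) where λ¹, λ², λ³ are partitions into even parts, λ⁴ is a staircase partition, λ⁵ is a partition into distinct multiples of 3, and |λ¹|+|λ²|+|λ³|+|λ⁴|+|λ⁵| = n. -/
open PowerSeries PowerSeries.WithPiTopology Filter Topology in
theorem tendsto_prod_range_one_sub_X_pow (g : ℕ → ℕ) (hg : ∀ i, i < g i) :
    ∃ L : ℤ⟦X⟧, Tendsto (fun N ↦ ∏ i ∈ Finset.range N, (1 - (X : ℤ⟦X⟧) ^ g i)) atTop (𝓝 L) := by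
  have h : Multipliable fun i ↦ (1 : ℤ⟦X⟧) + -X ^ g i := by
    apply multipliable_one_add_of_tendsto_order_atTop_nhds_top
    refine ENat.tendsto_nhds_top_iff_natCast_lt.mpr fun n ↦ eventually_atTop.mpr ⟨n, fun m hm ↦ ?_⟩
    rw [order_neg, order_X_pow]
    exact_mod_cast hm.trans_lt (hg m)
  simp_rw [← sub_eq_add_neg] at h
  exact ⟨_, h.hasProd.tendsto_prod_nat⟩

theorem prod_range_mul_of_dvd {M : Type*} [CommMonoid M] (k : ℕ) (hk : 0 < k) (f : ℕ → M) (N : ℕ) :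
    ∏ i ∈ Finset.range (k * N), (if k ∣ i + 1 then f (i + 1) else 1) =
      ∏ i ∈ Finset.range N, f (k * (i + 1)) := by
  induction N with
  | zero => simp
  | succ N ih =>
    rw [mul_add, mul_one, Finset.prod_range_add, ih, Finset.prod_range_succ]
    congr 1
    rw [Finset.prod_eq_single (k - 1)]
    · have : k * N + (k - 1) + 1 = k * (N + 1) := by rw [mul_add]; omega
      rw [this, if_pos (dvd_mul_right _ _)]
    · intro i hi hne
      rw [Finset.mem_range] at hi
      rw [if_neg]
      rw [add_assoc, Nat.dvd_add_right (dvd_mul_right _ _)]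
      intro h
      have := Nat.le_of_dvd (by omega) h
      omega
    · intro h
      exact absurd (Finset.mem_range.mpr (by omega)) h

open PowerSeries in
theorem exists_one_sub_X_pow_mul_eq_one (n : ℕ) :
    ∃ v : ℤ⟦X⟧, (1 - X ^ (n + 1)) * v = 1 := by
  refine IsUnit.exists_right_inv ?_
  rw [PowerSeries.isUnit_iff_constantCoeff]
  simp

/-- The finite form, due to Shanks, of the identity of Gauss: `v i` plays the role of `1 / (1 - x ^ (2 * i + 1))`. -/
theorem sum_prod_Ico_mul_pow {R : Type*} [CommRing R] (x : R) (v : ℕ → R)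
    (hv : ∀ i, (1 - x ^ (2 * i + 1)) * v i = 1) (n : ℕ) :
    ∑ s ∈ Finset.range n, (∏ i ∈ Finset.Ico s n, (1 - x ^ (2 * i + 2)) * v i) *
        x ^ (s * (2 * n + 1)) =
      ∑ s ∈ Finset.range (2 * n), x ^ (∑ i ∈ Finset.range (s + 1), i) := by
  induction n with
  | zero => simp
  | succ n ih =>
    set Q : ℕ → R := fun s ↦ ∏ i ∈ Finset.Ico s n, (1 - x ^ (2 * i + 2)) * v i with hQ
    have hQn : Q n = 1 := by simp [hQ]
    have step : ∀ m ≤ n, ∑ s ∈ Finset.range m,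
        ((∏ i ∈ Finset.Ico s (n + 1), (1 - x ^ (2 * i + 2)) * v i) * x ^ (s * (2 * (n + 1) + 1)) -
          Q s * x ^ (s * (2 * n + 1))) =
        Q m * x ^ (m * (2 * n + 1)) * (1 - x ^ (2 * m)) * v n := by
      intro m hm
      induction m with
      | zero => simp
      | succ m ihm =>
        rw [Finset.sum_range_succ, ihm (by omega), Finset.prod_Ico_succ_top (by omega)]
        have h1 : Q m = (1 - x ^ (2 * m + 2)) * v m * Q (m + 1) := by
          simp only [hQ]; rw [Finset.prod_eq_prod_Ico_succ_bot (by omega)]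
        change Q m * x ^ (m * (2 * n + 1)) * (1 - x ^ (2 * m)) * v n +
          (Q m * ((1 - x ^ (2 * n + 2)) * v n) * x ^ (m * (2 * (n + 1) + 1)) -
          Q m * x ^ (m * (2 * n + 1))) = _
        have h2 : Q m * (1 - x ^ (2 * m + 1)) = (1 - x ^ (2 * m + 2)) * Q (m + 1) := by
          rw [h1]; linear_combination (1 - x ^ (2 * m + 2)) * Q (m + 1) * hv m
        linear_combination (-Q m * x ^ (m * (2 * n + 1))) * (-hv n) +
          x ^ (2 * n + 1) * x ^ (m * (2 * n + 1)) * v n * h2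
    have key := step n le_rfl
    rw [Finset.sum_sub_distrib, ih, hQn] at key
    have e1 : ∑ i ∈ Finset.range (2 * n + 1), i = n * (2 * n + 1) := by
      have := Finset.sum_range_id_mul_two (2 * n + 1)
      simp only [Nat.add_sub_cancel] at this
      linarith
    have e2 : ∑ i ∈ Finset.range (2 * n + 1 + 1), i = (n + 1) * (2 * n + 1) := by
      rw [Finset.sum_range_succ, e1]; ring
    rw [show 2 * (n + 1) = 2 * n + 1 + 1 by ring, Finset.sum_range_succ _ (2 * n + 1),
      Finset.sum_range_succ _ (2 * n), e1, e2, Finset.sum_range_succ, Finset.prod_Ico_succ_top le_rfl]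
    rw [show 2 * (n + 1) = 2 * n + 1 + 1 by ring] at key
    simp only [Finset.Ico_self, Finset.prod_empty]
    linear_combination key + x ^ (n * (2 * n + 1)) * (1 + x ^ (2 * n + 1)) * hv n

section GeneratingFunctions

open PowerSeries PowerSeries.WithPiTopology Filter Topology Finset

/-- The generating function of a weight `w`, assumed to have finite fibers. -/
noncomputable def weightGenFun {α : Type*} (w : α → ℕ) : ℤ⟦X⟧ :=
  PowerSeries.mk fun n ↦ (Nat.card {a // w a = n} : ℤ)

/-- The fiber of a sum of two weights, as a disjoint union of products of fibers. -/
def fiberAddEquiv {α β : Type*} (w : α → ℕ) (v : β → ℕ) (n : ℕ) :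
    {p : α × β // w p.1 + v p.2 = n} ≃
      (Σ ij : antidiagonal n, {a // w a = ij.1.1} × {b // v b = ij.1.2}) where
  toFun p := ⟨⟨(w p.1.1, v p.1.2), mem_antidiagonal.mpr p.2⟩, ⟨p.1.1, rfl⟩, ⟨p.1.2, rfl⟩⟩
  invFun q := ⟨(q.2.1.1, q.2.2.1), by
    rw [q.2.1.2, q.2.2.2]; exact mem_antidiagonal.mp q.1.2⟩
  left_inv p := rfl
  right_inv := by
    rintro ⟨⟨⟨i, j⟩, h⟩, ⟨a, ha⟩, ⟨b, hb⟩⟩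
    dsimp only at ha hb
    subst ha hb
    rfl

theorem finite_fiber_add {α β : Type*} {w : α → ℕ} {v : β → ℕ}
    (hw : ∀ n, Finite {a // w a = n}) (hv : ∀ n, Finite {b // v b = n}) (n : ℕ) :
    Finite {p : α × β // w p.1 + v p.2 = n} :=
  Finite.of_equiv _ (fiberAddEquiv w v n).symm

theorem weightGenFun_add {α β : Type*} {w : α → ℕ} {v : β → ℕ}
    (hw : ∀ n, Finite {a // w a = n}) (hv : ∀ n, Finite {b // v b = n}) :
    weightGenFun (fun p : α × β ↦ w p.1 + v p.2) = weightGenFun w * weightGenFun v := by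
  ext n
  rw [coeff_mul]
  simp only [weightGenFun, coeff_mk]
  rw [Nat.card_congr (fiberAddEquiv w v n), Nat.card_sigma]
  simp only [Nat.card_prod]
  push_cast
  exact Finset.sum_coe_sort (antidiagonal n) fun ij ↦
    (Nat.card {a // w a = ij.1} : ℤ) * Nat.card {b // v b = ij.2}

/-- Partitions of `n`, as multisets of positive numbers, with a property `P`. -/
def partitionFiberEquiv (P : Multiset ℕ → Prop) (n : ℕ) :
    {m : {m : Multiset ℕ // IsPartitionM m ∧ P m} // m.1.sum = n} ≃
      {p : n.Partition // P p.parts} where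
  toFun m := ⟨⟨m.1.1, fun h ↦ m.1.2.1 _ h, m.2⟩, m.1.2.2⟩
  invFun p := ⟨⟨p.1.parts, fun _ h ↦ p.1.parts_pos h, p.2⟩, p.1.parts_sum⟩
  left_inv _ := rfl
  right_inv _ := rfl

theorem finite_partition_fiber (P : Multiset ℕ → Prop) (n : ℕ) :
    Finite {m : {m : Multiset ℕ // IsPartitionM m ∧ P m} // m.1.sum = n} :=
  Finite.of_equiv _ (partitionFiberEquiv P n).symm

theorem weightGenFun_partition (P : Multiset ℕ → Prop) (q : ℕ → ℕ → Prop)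
    [∀ i c, Decidable (q i c)] (h : ∀ m : Multiset ℕ, P m ↔ ∀ i ∈ m, q i (m.count i)) :
    weightGenFun (fun m : {m : Multiset ℕ // IsPartitionM m ∧ P m} ↦ m.1.sum) =
      Nat.Partition.genFun fun i c ↦ if q i c then 1 else 0 := by
  classical
  ext n
  rw [Nat.Partition.coeff_genFun, weightGenFun, coeff_mk, Nat.card_congr (partitionFiberEquiv P n),
    Nat.card_eq_fintype_card, Fintype.card_subtype, Finset.card_filter]
  push_cast
  refine Finset.sum_congr rfl fun p _ ↦ ?_
  rw [Finsupp.prod, Multiset.toFinsupp_support]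
  simp only [Multiset.toFinsupp_apply]
  split_ifs with hp
  · refine (Finset.prod_eq_one fun i hi ↦ if_pos ?_).symm
    exact (h _).mp hp i (Multiset.mem_toFinset.mp hi)
  · rw [h] at hp
    push Not at hp
    obtain ⟨i, hi, hq⟩ := hp
    exact (Finset.prod_eq_zero (Multiset.mem_toFinset.mpr hi) (if_neg hq)).symm

theorem weightGenFun_even :
    weightGenFun (fun m : {m : Multiset ℕ // IsEvenPartition m} ↦ m.1.sum) =
      Nat.Partition.genFun fun i _ ↦ if 2 ∣ i then 1 else 0 :=
  weightGenFun_partition (fun m ↦ ∀ i ∈ m, Even i) (fun i _ ↦ 2 ∣ i) fun m ↦ by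
    simp only [even_iff_two_dvd]

theorem weightGenFun_distinctMul3 :
    weightGenFun (fun m : {m : Multiset ℕ // IsDistinctMul3 m} ↦ m.1.sum) =
      Nat.Partition.genFun fun i c ↦ if 3 ∣ i ∧ c ≤ 1 then 1 else 0 := by
  refine weightGenFun_partition (fun m ↦ m.Nodup ∧ ∀ i ∈ m, 3 ∣ i) (fun i c ↦ 3 ∣ i ∧ c ≤ 1)
    fun m ↦ ?_
  rw [Multiset.nodup_iff_count_le_one]
  refine ⟨fun h i hi ↦ ⟨h.2 i hi, h.1 i⟩, fun h ↦ ⟨fun i ↦ ?_, fun i hi ↦ (h i hi).1⟩⟩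
  by_cases hi : i ∈ m
  · exact (h i hi).2
  · simp [Multiset.count_eq_zero_of_notMem hi]

/-- Designated partitions of `n`, as a partition with a choice for each of its part sizes. -/
def designatedFiberEquiv (n : ℕ) :
    {x : {x : Multiset ℕ × (ℕ → ℕ) // IsDesignated x} // x.1.1.sum = n} ≃
      (Σ p : n.Partition, (s : p.parts.toFinset) → Fin (p.parts.count s.1)) where
  toFun x := ⟨⟨x.1.1.1, fun h ↦ x.1.2.1 _ h, x.2⟩, fun s ↦ ⟨x.1.1.2 s.1 - 1, by
    have h := Multiset.count_pos.mpr (Multiset.mem_toFinset.mp s.2)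
    have := (x.1.2.2 s.1).1 h
    change _ < x.1.1.1.count s.1
    omega⟩⟩
  invFun y := ⟨⟨(y.1.parts, fun s ↦ if h : s ∈ y.1.parts.toFinset then (y.2 ⟨s, h⟩ : ℕ) + 1 else 0),
    fun _ h ↦ y.1.parts_pos h, fun s ↦ by
      by_cases h : s ∈ y.1.parts.toFinset
      · have h2 := (y.2 ⟨s, h⟩).2
        have h1 := Multiset.count_pos.mpr (Multiset.mem_toFinset.mp h)
        simp only [h, dite_true]
        exact ⟨fun _ ↦ ⟨Nat.le_add_left _ _, h2⟩, fun h0 ↦ absurd h0 h1.ne'⟩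
      · have h2 : s ∉ y.1.parts := by simpa using h
        simp only [h, dite_false, Multiset.count_eq_zero_of_notMem h2]
        exact ⟨fun h0 ↦ absurd h0 (lt_irrefl 0), fun _ ↦ trivial⟩⟩, y.1.parts_sum⟩
  left_inv x := by
    refine Subtype.ext (Subtype.ext (Prod.ext rfl (funext fun s ↦ ?_)))
    have := x.1.2.2 s
    by_cases h : s ∈ x.1.1.1
    · have h1 := (this.1 (Multiset.count_pos.mpr h)).1
      simp only [Multiset.mem_toFinset, h, dite_true]
      omega
    · have h1 := this.2 (Multiset.count_eq_zero_of_notMem h)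
      simp only [Multiset.mem_toFinset, h, dite_false, h1]
  right_inv y := by
    obtain ⟨p, f⟩ := y
    refine Sigma.ext rfl (heq_of_eq (funext fun s ↦ Fin.ext ?_))
    simp

theorem finite_designated_fiber (n : ℕ) :
    Finite {x : {x : Multiset ℕ × (ℕ → ℕ) // IsDesignated x} // x.1.1.sum = n} :=
  Finite.of_equiv _ (designatedFiberEquiv n).symm

theorem weightGenFun_designated :
    weightGenFun (fun x : {x : Multiset ℕ × (ℕ → ℕ) // IsDesignated x} ↦ x.1.1.sum) =
      Nat.Partition.genFun fun _ c ↦ (c : ℤ) := by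
  ext n
  rw [Nat.Partition.coeff_genFun, weightGenFun, coeff_mk, Nat.card_congr (designatedFiberEquiv n),
    Nat.card_sigma]
  push_cast
  refine Finset.sum_congr rfl fun p _ ↦ ?_
  rw [Nat.card_pi, Finset.prod_coe_sort p.parts.toFinset fun s ↦ Nat.card (Fin (p.parts.count s))]
  simp [Finsupp.prod]

/-- Staircases of size `n` correspond to the lengths `k` with `0 + 1 + ⋯ + k = n`. -/
noncomputable def staircaseFiberEquiv (n : ℕ) :
    {m : {m : Multiset ℕ // IsStaircase m} // m.1.sum = n} ≃
      {k : ℕ // ∑ i ∈ range (k + 1), i = n} :=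
  have hsum (k : ℕ) : ((Multiset.range k).map (· + 1)).sum = ∑ i ∈ range (k + 1), i := by
    rw [Finset.sum_range_succ']; rfl
  (Equiv.ofBijective
    (fun k ↦ ⟨⟨(Multiset.range k.1).map (· + 1), k.1, rfl⟩, (hsum k.1).trans k.2⟩) (by
      constructor
      · intro a b h
        have := congrArg (fun m ↦ Multiset.card m.1.1) h
        simpa [Subtype.ext_iff] using this
      · rintro ⟨⟨m, k, rfl⟩, h⟩
        exact ⟨⟨k, (hsum k).symm.trans h⟩, rfl⟩)).symm

theorem le_sum_range_succ_id (k : ℕ) : k ≤ ∑ i ∈ range (k + 1), i :=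
  Finset.single_le_sum (f := fun i ↦ i) (fun _ _ ↦ Nat.zero_le _) (by simp)

theorem finite_staircase_fiber (n : ℕ) :
    Finite {m : {m : Multiset ℕ // IsStaircase m} // m.1.sum = n} := by
  have : Finite {k : ℕ // ∑ i ∈ range (k + 1), i = n} :=
    ((Set.finite_Iic n).subset fun k hk ↦ (le_sum_range_succ_id k).trans_eq hk).to_subtype
  exact Finite.of_equiv _ (staircaseFiberEquiv n).symm

theorem coeff_weightGenFun_staircase {n N : ℕ} (h : n < N) :
    coeff n (weightGenFun fun m : {m : Multiset ℕ // IsStaircase m} ↦ m.1.sum) =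
      coeff n (∑ s ∈ range N, (X : ℤ⟦X⟧) ^ (∑ i ∈ range (s + 1), i)) := by
  rw [weightGenFun, coeff_mk, Nat.card_congr (staircaseFiberEquiv n), map_sum]
  simp_rw [coeff_X_pow]
  rw [Finset.sum_boole, ← Nat.card_eq_finsetCard]
  refine congrArg _ (Nat.card_congr (Equiv.subtypeEquivRight fun k ↦ ?_))
  rw [Finset.mem_filter, Finset.mem_range, eq_comm]
  exact ⟨fun hk ↦ ⟨((le_sum_range_succ_id k).trans_eq hk.symm).trans_lt h, hk⟩, And.right⟩

end GeneratingFunctions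

section ProductFormulas

open PowerSeries PowerSeries.WithPiTopology Filter Topology Finset

theorem one_add_tsum_designated_mul (n : ℕ) :
    (1 + ∑' j, ((j + 1 : ℕ) : ℤ) • (X : ℤ⟦X⟧) ^ ((n + 1) * (j + 1))) *
      ((1 - X ^ (n + 1)) * (1 - X ^ (2 * (n + 1)))) = 1 + X ^ (3 * (n + 1)) := by
  set u : ℤ⟦X⟧ := X ^ (n + 1) with hu
  have hu0 : constantCoeff u = 0 := by simp [hu]
  have hB : Summable fun j : ℕ ↦ ((j + 1 : ℕ) : ℤ) • u ^ (j + 1) := by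
    have h := Nat.Partition.summable_genFun_term (fun _ c ↦ (c : ℤ)) n
    simp only [pow_mul] at h
    exact h
  simp only [mul_comm _ (n + 1), pow_mul, ← hu]
  set B : ℤ⟦X⟧ := ∑' j, ((j + 1 : ℕ) : ℤ) • u ^ (j + 1) with hBdef
  have hgs := summable_pow_of_constantCoeff_eq_zero hu0
  have hg := tsum_pow_mul_one_sub_of_constantCoeff_eq_zero hu0
  set g : ℤ⟦X⟧ := ∑' i, u ^ i with hgdef
  have hshift : B - B * u = g * u := by
    have hmul (j : ℕ) : ((j + 1 : ℕ) : ℤ) • u ^ (j + 1) * u = ((j + 1 : ℕ) : ℤ) • u ^ (j + 1 + 1) := by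
      rw [smul_mul_assoc, ← pow_succ]
    have h0 : Summable fun j : ℕ ↦ ((j + 1 : ℕ) : ℤ) • u ^ (j + 1 + 1) :=
      (hB.mul_right u).congr hmul
    have h2 : Summable fun j : ℕ ↦ (j : ℤ) • u ^ (j + 1) :=
      (summable_nat_add_iff (f := fun j : ℕ ↦ (j : ℤ) • u ^ (j + 1)) 1).mp h0
    have h1 : B * u = ∑' j : ℕ, (j : ℤ) • u ^ (j + 1) := by
      rw [tsum_eq_zero_add' (f := fun j : ℕ ↦ (j : ℤ) • u ^ (j + 1)) h0, hBdef, ← hB.tsum_mul_right,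
        Nat.cast_zero, zero_smul, zero_add]
      exact tsum_congr hmul
    rw [h1, hBdef, ← hB.tsum_sub h2, hgdef, ← hgs.tsum_mul_right]
    refine tsum_congr fun j ↦ ?_
    push_cast
    rw [← sub_smul, pow_succ]
    simp
  linear_combination (1 - u ^ 2) * hshift + u * (1 + u) * hg

theorem one_add_tsum_distinctMul3 (n : ℕ) :
    (1 + ∑' j, (if 3 ∣ n + 1 ∧ j + 1 ≤ 1 then (1 : ℤ) else 0) • (X : ℤ⟦X⟧) ^ ((n + 1) * (j + 1))) =
      if 3 ∣ n + 1 then 1 + X ^ (n + 1) else 1 := by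
  rw [tsum_eq_single 0 fun j hj ↦ by rw [if_neg (by omega), zero_smul]]
  split_ifs <;> simp_all

theorem one_add_tsum_even_mul (n : ℕ) :
    (1 + ∑' j, (if 2 ∣ n + 1 then (1 : ℤ) else 0) • (X : ℤ⟦X⟧) ^ ((n + 1) * (j + 1))) *
      (if 2 ∣ n + 1 then 1 - X ^ (n + 1) else 1) = 1 := by
  split_ifs with h
  · have h0 : constantCoeff ((X : ℤ⟦X⟧) ^ (n + 1)) = 0 := by simp
    have h1 := tsum_pow_mul_one_sub_of_constantCoeff_eq_zero h0
    rw [(summable_pow_of_constantCoeff_eq_zero h0).tsum_eq_zero_add] at h1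
    simpa [pow_mul] using h1
  · simp

/-- The identity of Gauss for the generating function of the triangular numbers. -/
theorem tendsto_prod_staircase (v : ℕ → ℤ⟦X⟧) (hv : ∀ i, (1 - X ^ (2 * i + 1)) * v i = 1) :
    Tendsto (fun N ↦ ∏ i ∈ range N, (1 - X ^ (2 * i + 2)) * v i) atTop
      (𝓝 (weightGenFun fun m : {m : Multiset ℕ // IsStaircase m} ↦ m.1.sum)) := by
  rw [tendsto_iff_coeff_tendsto]
  refine fun d ↦ tendsto_atTop_of_eventually_const (i₀ := d + 1) fun N hN ↦ ?_
  obtain ⟨N, rfl⟩ : ∃ k, N = k + 1 := ⟨N - 1, by omega⟩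
  rw [coeff_weightGenFun_staircase (N := 2 * (N + 1)) (by omega), ← sum_prod_Ico_mul_pow X v hv,
    Finset.sum_range_succ', map_add, map_sum, Finset.sum_eq_zero, zero_add]
  · simp
  · intro s _
    rw [coeff_mul_X_pow', if_neg]
    rw [add_mul]
    omega

theorem genFun_designated_eq :
    Nat.Partition.genFun (fun _ c ↦ (c : ℤ)) =
      (Nat.Partition.genFun fun i _ ↦ if 2 ∣ i then 1 else 0) ^ 3 *
      weightGenFun (fun m : {m : Multiset ℕ // IsStaircase m} ↦ m.1.sum) *
      Nat.Partition.genFun fun i c ↦ if 3 ∣ i ∧ c ≤ 1 then 1 else 0 := by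
  obtain ⟨a, ha⟩ := tendsto_prod_range_one_sub_X_pow (fun i ↦ i + 1) (fun i ↦ by omega)
  obtain ⟨e, he⟩ := tendsto_prod_range_one_sub_X_pow (fun i ↦ 2 * (i + 1)) (fun i ↦ by omega)
  obtain ⟨o, ho⟩ := tendsto_prod_range_one_sub_X_pow (fun i ↦ 2 * i + 1) (fun i ↦ by omega)
  choose v hv using fun i ↦ exists_one_sub_X_pow_mul_eq_one (2 * i)
  have hS := tendsto_prod_staircase v hv
  have hD := (Nat.Partition.hasProd_genFun (R := ℤ) fun _ c ↦ (c : ℤ)).tendsto_prod_nat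
  have hE := (Nat.Partition.hasProd_genFun (R := ℤ) fun i _ ↦ if 2 ∣ i then 1 else 0).tendsto_prod_nat
  have hT := ((Nat.Partition.hasProd_genFun (R := ℤ)
    fun i c ↦ if 3 ∣ i ∧ c ≤ 1 then 1 else 0).tendsto_prod_nat).congr
      fun N ↦ Finset.prod_congr rfl fun i _ ↦ one_add_tsum_distinctMul3 i
  set D := Nat.Partition.genFun (R := ℤ) fun _ c ↦ (c : ℤ)
  set E := Nat.Partition.genFun (R := ℤ) fun i _ ↦ if 2 ∣ i then 1 else 0
  set T := Nat.Partition.genFun (R := ℤ) fun i c ↦ if 3 ∣ i ∧ c ≤ 1 then 1 else 0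
  set S := weightGenFun fun m : {m : Multiset ℕ // IsStaircase m} ↦ m.1.sum
  have hmul (k : ℕ) (hk : 0 < k) : Tendsto (fun N ↦ k * N) atTop atTop :=
    tendsto_id.const_mul_atTop' hk
  have hae : a = e * o := by
    refine tendsto_nhds_unique (ha.comp (hmul 2 two_pos)) ((he.mul ho).congr fun N ↦ ?_)
    rw [Function.comp_apply]
    induction N with
    | zero => simp
    | succ N ih =>
      rw [Finset.prod_range_succ, Finset.prod_range_succ, mul_add, Finset.prod_range_succ,
        Finset.prod_range_succ, ← ih]
      ring
  have hSo : S * o = e := by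
    refine tendsto_nhds_unique (hS.mul ho) (he.congr fun N ↦ ?_)
    rw [← Finset.prod_mul_distrib]
    refine Finset.prod_congr rfl fun i _ ↦ ?_
    linear_combination (-(1 - (X : ℤ⟦X⟧) ^ (2 * i + 2))) * hv i
  have hEe : E * e = 1 := by
    refine tendsto_nhds_unique ((hE.comp (hmul 2 two_pos)).mul he)
      (tendsto_const_nhds.congr fun N ↦ ?_)
    rw [Function.comp_apply, ← prod_range_mul_of_dvd 2 two_pos (fun i ↦ 1 - (X : ℤ⟦X⟧) ^ i),
      ← Finset.prod_mul_distrib]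
    exact (Finset.prod_eq_one fun i _ ↦ one_add_tsum_even_mul i).symm
  have hDT : D * (a * e) = T := by
    refine tendsto_nhds_unique (hD.mul (ha.mul he)) ((hT.comp (hmul 3 three_pos)).congr fun N ↦ ?_)
    rw [Function.comp_apply, prod_range_mul_of_dvd 3 three_pos (fun i ↦ 1 + (X : ℤ⟦X⟧) ^ i),
      ← Finset.prod_mul_distrib, ← Finset.prod_mul_distrib]
    exact Finset.prod_congr rfl fun i _ ↦ (one_add_tsum_designated_mul i).symm
  rw [← hDT, hae]
  have h3 : E ^ 3 * e ^ 3 = 1 := by rw [← mul_pow, hEe, one_pow]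
  linear_combination (-D) * h3 - E ^ 3 * D * e ^ 2 * hSo

end ProductFormulas

theorem designated_bijection (n : ℕ) :
    Nonempty ({x : Multiset ℕ × (ℕ → ℕ) // IsDesignated x ∧ x.1.sum = n} ≃
      {t : Multiset ℕ × Multiset ℕ × Multiset ℕ × Multiset ℕ × Multiset ℕ //
        IsEvenPartition t.1 ∧ IsEvenPartition t.2.1 ∧ IsEvenPartition t.2.2.1 ∧
        IsStaircase t.2.2.2.1 ∧ IsDistinctMul3 t.2.2.2.2 ∧
        t.1.sum + t.2.1.sum + t.2.2.1.sum + t.2.2.2.1.sum + t.2.2.2.2.sum = n}) := by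
  have hE : ∀ n, Finite {m : {m : Multiset ℕ // IsEvenPartition m} // m.1.sum = n} :=
    finite_partition_fiber _
  have hT : ∀ n, Finite {m : {m : Multiset ℕ // IsDistinctMul3 m} // m.1.sum = n} :=
    finite_partition_fiber _
  have h4 := finite_fiber_add finite_staircase_fiber hT
  have h3 := finite_fiber_add hE h4
  have h2 := finite_fiber_add hE h3
  have h1 := finite_fiber_add hE h2
  have key := genFun_designated_eq
  rw [← weightGenFun_designated, ← weightGenFun_even, ← weightGenFun_distinctMul3, pow_succ, sq,
    mul_assoc, mul_assoc, mul_assoc, ← weightGenFun_add finite_staircase_fiber hT,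
    ← weightGenFun_add hE h4, ← weightGenFun_add hE h3, ← weightGenFun_add hE h2] at key
  have hcard := congrArg (PowerSeries.coeff n) key
  simp only [weightGenFun, PowerSeries.coeff_mk, Nat.cast_inj] at hcard
  have := finite_designated_fiber n
  have := h1 n
  obtain ⟨φ⟩ := Finite.card_eq.mp hcard
  refine ⟨(Equiv.subtypeSubtypeEquivSubtypeInter _ _).symm.trans
    (φ.trans ?_)⟩
  exact
    { toFun := fun p ↦ ⟨(p.1.1.1, p.1.2.1.1, p.1.2.2.1.1, p.1.2.2.2.1.1, p.1.2.2.2.2.1),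
        p.1.1.2, p.1.2.1.2, p.1.2.2.1.2, p.1.2.2.2.1.2, p.1.2.2.2.2.2, by
          have := p.2; simpa only [add_assoc] using this⟩
      invFun := fun t ↦ ⟨(⟨_, t.2.1⟩, ⟨_, t.2.2.1⟩, ⟨_, t.2.2.2.1⟩, ⟨_, t.2.2.2.2.1⟩,
        ⟨_, t.2.2.2.2.2.1⟩), by
          have := t.2.2.2.2.2.2; simpa only [add_assoc] using this⟩
      left_inv := fun _ ↦ rfl
      right_inv := fun _ ↦ rfl }
end

section
/- The number of overpartition pairs of n, p̄_{-2}(n), has generating function whose relevant structure implies: the number of quadruples (λ¹, λ², λ³, λ⁴) with λ¹, λ², λ³ partitions into even parts and λ⁴ a 'signed staircase' object of size a perfect square (with appropriate multiplicity), total size 3n+2, is divisible by 3; hence p̄_{-2}(3n+2) ≡ 0 (mod 3). -/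
open PowerSeries

section QSeries

variable {K : Type*} [Field K]

/-- The `q`-Pochhammer symbol `(q; q)_n`. -/
def qPoch {R : Type*} [CommRing R] (q : R) (n : ℕ) : R := ∏ i ∈ Finset.range n, (1 - q ^ (i + 1))

lemma qPoch_succ {R : Type*} [CommRing R] (q : R) (n : ℕ) :
    qPoch q (n + 1) = qPoch q n * (1 - q ^ (n + 1)) :=
  Finset.prod_range_succ _ _

/-- The coefficient of `q ^ (k ^ 2)` in the theta series `∑ k : ℤ, (-1) ^ k * q ^ (k ^ 2)`. -/
def thetaCoeff (R : Type*) [Ring R] (k : ℕ) : R := if k = 0 then 1 else 2 * (-1) ^ k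

lemma thetaCoeff_succ (k : ℕ) : thetaCoeff K (k + 1) = 2 * (-1) ^ (k + 1) := by
  simp [thetaCoeff]

lemma map_thetaCoeff {R S : Type*} [Ring R] [Ring S] (f : R →+* S) (k : ℕ) :
    f (thetaCoeff R k) = thetaCoeff S k := by
  unfold thetaCoeff
  split <;> simp [map_ofNat]

lemma qPoch_ne_zero {q : K} (hq : ∀ m, q ^ (m + 1) ≠ 1) (n : ℕ) : qPoch q n ≠ 0 :=
  Finset.prod_ne_zero_iff.2 fun i _ => sub_ne_zero.2 (hq i).symm

lemma partial_theta_sum {q : K} (hq : ∀ m, q ^ (m + 1) ≠ 1) (r j : ℕ) :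
    ∑ k ∈ Finset.range (j + 1), thetaCoeff K k * q ^ (k ^ 2) /
        (qPoch q (j + r + 1 - k) * qPoch q (j + r + 1 + k)) -
      (∑ k ∈ Finset.range (j + 1), thetaCoeff K k * q ^ (k ^ 2) /
        (qPoch q (j + r - k) * qPoch q (j + r + k))) / (1 - q ^ (2 * (j + r) + 2)) =
    2 * (-1) ^ j * q ^ (j ^ 2 + (2 * j + r + 1)) * (1 - q ^ (r + 1)) /
      (qPoch q (r + 1) * qPoch q (2 * j + r + 1)) / (1 - q ^ (2 * (j + r) + 2)) := by
  have hD := qPoch_ne_zero hq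
  have h1 : ∀ m, 1 - q ^ (m + 1) ≠ 0 := fun m => sub_ne_zero.2 (hq m).symm
  induction j generalizing r with
  | zero =>
    have a := hD r
    have b := h1 r
    have c := h1 (2 * r + 1)
    have c' : q ^ (2 * r + 1 + 1) = (q ^ (r + 1)) ^ 2 := by ring
    simp [thetaCoeff, qPoch_succ]
    rw [show 2 * r + 2 = 2 * r + 1 + 1 by ring]
    field_simp
    rw [c']
    ring
  | succ j ih =>
    rw [Finset.sum_range_succ, Finset.sum_range_succ _ (j + 1)]
    have ih := ih (r + 1)
    rw [show j + (r + 1) = j + 1 + r by ring] at ih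
    rw [add_div, add_sub_add_comm, ih, thetaCoeff_succ]
    rw [show j + 1 + r + 1 - (j + 1) = r + 1 by omega, show j + 1 + r - (j + 1) = r by omega,
      show j + 1 + r + 1 + (j + 1) = (2 * j + r + 2) + 1 by ring,
      show j + 1 + r + (j + 1) = 2 * j + r + 2 by ring,
      show 2 * j + (r + 1) + 1 = 2 * j + r + 2 by ring,
      show 2 * (j + 1) + r + 1 = (2 * j + r + 2) + 1 by ring,
      show 2 * (j + 1 + r) + 2 = 2 * j + 2 * r + 3 + 1 by ring]
    rw [qPoch_succ q (r + 1), qPoch_succ q r, qPoch_succ q (2 * j + r + 2)]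
    have a := hD r
    have a' := hD (2 * j + r + 2)
    have b := h1 r
    have b' := h1 (r + 1)
    have c := h1 (2 * j + 2 * r + 3)
    have d := h1 (2 * j + r + 2)
    field_simp
    ring

/-- A finite form of Gauss's identity `∑ (-1) ^ k * q ^ (k ^ 2) = (q; q)_∞ / (-q; q)_∞`. -/
lemma theta_sum_eq {q : K} (hq : ∀ m, q ^ (m + 1) ≠ 1) (hq' : ∀ m, q ^ (m + 1) ≠ -1) (n : ℕ) :
    ∑ k ∈ Finset.range (n + 1), thetaCoeff K k * q ^ (k ^ 2) / (qPoch q (n - k) * qPoch q (n + k)) =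
      1 / (qPoch q n * ∏ i ∈ Finset.range n, (1 + q ^ (i + 1))) := by
  have hD := qPoch_ne_zero hq
  have h1 : ∀ m, 1 - q ^ (m + 1) ≠ 0 := fun m => sub_ne_zero.2 (hq m).symm
  have h2 : ∀ m, 1 + q ^ (m + 1) ≠ 0 := fun m h => hq' m (by linear_combination h)
  have hE : ∏ i ∈ Finset.range n, (1 + q ^ (i + 1)) ≠ 0 := Finset.prod_ne_zero_iff.2 fun i _ => h2 i
  induction n with
  | zero => simp [thetaCoeff, qPoch]
  | succ n ih =>
    have hE' : ∏ i ∈ Finset.range n, (1 + q ^ (i + 1)) ≠ 0 :=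
      Finset.prod_ne_zero_iff.2 fun i _ => h2 i
    have h := partial_theta_sum hq 0 n
    simp only [add_zero] at h
    rw [ih hE'] at h
    rw [Finset.sum_range_succ, eq_add_of_sub_eq h, thetaCoeff_succ, Finset.prod_range_succ,
      show n + 1 - (n + 1) = 0 by omega, show n + 1 + (n + 1) = 2 * n + 1 + 1 by ring,
      qPoch_succ q n, qPoch_succ q (2 * n + 1), show 2 * n + 2 = 2 * n + 1 + 1 by ring]
    have a := hD n
    have b := hD (2 * n + 1)
    have c := h1 n
    have d := h2 n
    have e := h1 (2 * n + 1)
    have e' : q ^ (2 * n + 1 + 1) = (q ^ (n + 1)) ^ 2 := by ring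
    have f : 1 - q ≠ 0 := by simpa using h1 0
    simp [qPoch]
    rw [show ∏ i ∈ Finset.range (2 * n + 1), (1 - q ^ (i + 1)) = qPoch q (2 * n + 1) from rfl,
      show ∏ i ∈ Finset.range n, (1 - q ^ (i + 1)) = qPoch q n from rfl]
    field_simp
    ring

end QSeries

lemma sq_mod_three_ne_two (k : ℕ) : k ^ 2 % 3 ≠ 2 := by
  have hk : k % 3 = 0 ∨ k % 3 = 1 ∨ k % 3 = 2 := by omega
  rw [Nat.pow_mod]
  rcases hk with hk | hk | hk <;> simp [hk]

lemma three_dvd_card_of_fixedPointFree {α : Type*} (f : α → α) (hf : ∀ x, f (f (f x)) = x)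
    (h : ∀ x, f x ≠ x) :
    3 ∣ Nat.card α := by
  classical
  cases finite_or_infinite α
  · have := Fintype.ofFinite α
    have : Fact (Nat.Prime 3) := ⟨Nat.prime_three⟩
    have key := Equiv.Perm.card_fixedPoints_modEq (f := (f : Function.End α)) (p := 3) (n := 1)
      (funext hf)
    have : IsEmpty (Function.fixedPoints f) := ⟨fun x => h x.1 x.2⟩
    rw [Nat.card_eq_fintype_card, ← Nat.modEq_zero_iff_dvd]
    exact key.trans (by rw [Fintype.card_eq_zero_iff.2 this])
  · simp

lemma constantCoeff_qPoch (k : Type*) [Field k] (n : ℕ) :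
    constantCoeff (qPoch (X : k⟦X⟧) n) = 1 := by
  simp [qPoch, map_prod]

lemma X_pow_dvd_qPoch_sub {R : Type*} [CommRing R] (a m : ℕ) :
    (X : R⟦X⟧) ^ (a + 1) ∣ qPoch X (a + m) - qPoch X a := by
  induction m with
  | zero => simp
  | succ m ih =>
    rw [← add_assoc, qPoch_succ]
    have : (X : R⟦X⟧) ^ (a + 1) ∣ qPoch X (a + m) * X ^ (a + m + 1) :=
      Dvd.dvd.mul_left (pow_dvd_pow _ (by omega)) _
    convert ih.sub this using 1
    ring

lemma theta_sum_powerSeries (k : Type*) [Field k] (n : ℕ) :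
    (∑ j ∈ Finset.range (n + 1), thetaCoeff k⟦X⟧ j * X ^ (j ^ 2) *
        (qPoch X n * qPoch X n * (qPoch X (n - j) * qPoch X (n + j))⁻¹)) *
      ∏ i ∈ Finset.range n, (1 + (X : k⟦X⟧) ^ (i + 1)) = qPoch X n := by
  let φ := algebraMap k⟦X⟧ (FractionRing k⟦X⟧)
  have hφ : Function.Injective φ := IsFractionRing.injective _ _
  have hX (c : k) (m : ℕ) : (X : k⟦X⟧) ^ (m + 1) ≠ C c := fun h => by
    have := congrArg (coeff (m + 1)) h
    simp at this
  have h₁ (m : ℕ) : φ X ^ (m + 1) ≠ 1 := by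
    rw [← map_pow, ← map_one φ]
    exact hφ.ne (by simpa using hX 1 m)
  have h₂ (m : ℕ) : φ X ^ (m + 1) ≠ -1 := by
    rw [← map_pow, ← map_one φ, ← map_neg]
    exact hφ.ne (by simpa using hX (-1) m)
  have hD (m : ℕ) : φ (qPoch X m) = qPoch (φ X) m := by simp [qPoch, map_prod]
  have hinv (a b : ℕ) : φ (qPoch X a * qPoch X b)⁻¹ = (qPoch (φ X) a * qPoch (φ X) b)⁻¹ := by
    rw [← hD, ← hD, ← map_mul]
    refine eq_inv_of_mul_eq_one_left ?_
    rw [← map_mul, PowerSeries.inv_mul_cancel _ (by simp [constantCoeff_qPoch]), map_one]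
  have hc (j : ℕ) : φ (thetaCoeff k⟦X⟧ j) = thetaCoeff _ j :=
    map_thetaCoeff φ j
  have key := theta_sum_eq h₁ h₂ n
  have hE : ∏ i ∈ Finset.range n, (1 + φ X ^ (i + 1)) ≠ 0 :=
    Finset.prod_ne_zero_iff.2 fun i _ h => h₂ i (by linear_combination h)
  have hDn := qPoch_ne_zero h₁ n
  apply hφ
  simp only [map_mul, map_sum, map_prod, map_add, map_pow, map_one, hinv, hc, hD]
  rw [eq_div_iff (mul_ne_zero hDn hE)] at key
  refine mul_left_cancel₀ hDn (Eq.trans ?_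
    (congrArg (· * (qPoch (φ X) n * qPoch (φ X) n)) key |>.trans
    (by ring)))
  simp only [Finset.mul_sum, Finset.sum_mul]
  refine Finset.sum_congr rfl fun j _ => ?_
  ring

lemma X_pow_dvd_theta (k : Type*) [Field k] (n : ℕ) :
    (X : k⟦X⟧) ^ (n + 1) ∣ (∑ j ∈ Finset.range (n + 1), thetaCoeff k⟦X⟧ j * X ^ (j ^ 2)) *
      ∏ i ∈ Finset.range n, (1 + (X : k⟦X⟧) ^ (i + 1)) - qPoch X n := by
  conv => rhs; rhs; rw [← theta_sum_powerSeries]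
  rw [← sub_mul, ← Finset.sum_sub_distrib]
  refine Dvd.dvd.mul_right (Finset.dvd_sum fun j hj => ?_) _
  obtain ⟨r, rfl⟩ : ∃ r, n = r + j := ⟨n - j, by simp at hj; omega⟩
  rw [show r + j - j = r by omega]
  set P := qPoch (X : k⟦X⟧) r * qPoch X (r + j + j) with hP
  have hinv : P * P⁻¹ = 1 := PowerSeries.mul_inv_cancel _ (by simp [hP, constantCoeff_qPoch])
  have h₁ := X_pow_dvd_qPoch_sub (R := k) r j
  have h₂ := X_pow_dvd_qPoch_sub (R := k) r (j + j)
  rw [← add_assoc] at h₂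
  have hd : (X : k⟦X⟧) ^ (r + 1) ∣ P - qPoch X (r + j) * qPoch X (r + j) := by
    obtain ⟨u, hu⟩ := h₁
    obtain ⟨v, hv⟩ := h₂
    rw [sub_eq_iff_eq_add] at hu hv
    rw [hP, hu, hv]
    exact ⟨qPoch X r * v - 2 * qPoch X r * u - X ^ (r + 1) * u * u, by ring⟩
  have : (X : k⟦X⟧) ^ (j ^ 2 + (r + 1)) ∣ thetaCoeff k⟦X⟧ j * X ^ (j ^ 2) - thetaCoeff k⟦X⟧ j *
      X ^ (j ^ 2) * (qPoch X (r + j) * qPoch X (r + j) * P⁻¹) := by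
    obtain ⟨u, hu⟩ := hd
    refine ⟨thetaCoeff k⟦X⟧ j * u * P⁻¹, ?_⟩
    rw [pow_add]
    linear_combination (thetaCoeff k⟦X⟧ j * X ^ (j ^ 2) * P⁻¹) * hu -
      thetaCoeff k⟦X⟧ j * X ^ (j ^ 2) * hinv
  refine (pow_dvd_pow _ ?_).trans this
  linarith [Nat.le_self_pow two_ne_zero j]

/-- The generating function of overpartitions. -/
noncomputable def overGenFun (R : Type*) [CommSemiring R] : R⟦X⟧ :=
  Nat.Partition.genFun fun _ _ => (2 : R)

open scoped PowerSeries.WithPiTopology in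
lemma X_pow_dvd_overGenFun (R : Type*) [CommRing R] (n : ℕ) :
    (X : R⟦X⟧) ^ (n + 1) ∣ overGenFun R * qPoch X n - ∏ i ∈ Finset.range n, (1 + X ^ (i + 1)) := by
  let : TopologicalSpace R := ⊥
  have : DiscreteTopology R := ⟨rfl⟩
  have hp := Nat.Partition.hasProd_genFun fun _ _ => (2 : R)
  set f : ℕ → R⟦X⟧ := fun i => 1 + ∑' j, (2 : R) • X ^ ((i + 1) * (j + 1)) with hf
  have hfac (i : ℕ) : f i * (1 - X ^ (i + 1)) = 1 + X ^ (i + 1) := by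
    have hs := Nat.Partition.summable_genFun_term (fun _ _ => (2 : R)) i
    have h := hs.tsum_eq_zero_add
    have : ∑' j, (2 : R) • (X : R⟦X⟧) ^ ((i + 1) * (j + 1 + 1)) =
        X ^ (i + 1) * ∑' j, (2 : R) • X ^ ((i + 1) * (j + 1)) := by
      rw [← hs.tsum_mul_left]
      refine tsum_congr fun j => ?_
      rw [mul_smul_comm, ← pow_add]
      ring_nf
    rw [this] at h
    simp only [zero_add, mul_one, two_smul] at h
    simp only [hf, two_smul]
    linear_combination h
  have hprod (m : ℕ) : (∏ i ∈ Finset.range m, f i) * qPoch X m =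
      ∏ i ∈ Finset.range m, (1 + X ^ (i + 1)) := by
    rw [qPoch, ← Finset.prod_mul_distrib]
    exact Finset.prod_congr rfl fun i _ => hfac i
  have hone (i : ℕ) : (X : R⟦X⟧) ^ (i + 1) ∣ f i - 1 := by
    refine ⟨f i + 1, ?_⟩
    linear_combination hfac i
  have hdvd (m : ℕ) : (X : R⟦X⟧) ^ (n + 1) ∣
      ∏ i ∈ Finset.range (n + m), f i - ∏ i ∈ Finset.range n, f i := by
    induction m with
    | zero => simp
    | succ m ih =>
      rw [← add_assoc, Finset.prod_range_succ]
      have := (pow_dvd_pow X (show n + 1 ≤ n + m + 1 by omega)).trans (hone (n + m))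
      convert ih.add (this.mul_left (∏ i ∈ Finset.range (n + m), f i)) using 1
      ring
  have hlim : (X : R⟦X⟧) ^ (n + 1) ∣ overGenFun R - ∏ i ∈ Finset.range n, f i := by
    rw [X_pow_dvd_iff]
    intro d hd
    have ht := ((WithPiTopology.continuous_coeff R d).tendsto _).comp hp.tendsto_prod_nat
    rw [map_sub, sub_eq_zero]
    refine tendsto_nhds_unique ht (tendsto_const_nhds.congr' ?_)
    filter_upwards [Filter.eventually_ge_atTop n] with m hm
    obtain ⟨m, rfl⟩ := Nat.exists_eq_add_of_le hm
    have := X_pow_dvd_iff.1 (hdvd m) d hd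
    rw [map_sub, sub_eq_zero] at this
    exact this.symm
  convert hlim.mul_right (qPoch X n) using 1
  rw [sub_mul, hprod]

lemma X_pow_dvd_overGenFun_mul_theta (k : Type*) [Field k] (n : ℕ) :
    (X : k⟦X⟧) ^ (n + 1) ∣
      overGenFun k * (∑ j ∈ Finset.range (n + 1), thetaCoeff k⟦X⟧ j * X ^ (j ^ 2)) - 1 := by
  have hE : IsUnit (∏ i ∈ Finset.range n, (1 + (X : k⟦X⟧) ^ (i + 1))) := by
    rw [isUnit_iff_constantCoeff]
    simp [map_prod]
  rw [← hE.dvd_mul_right]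
  convert ((X_pow_dvd_theta k n).mul_left (overGenFun k)).add (X_pow_dvd_overGenFun k n) using 1
  ring

lemma coeff_cube_eq_zero (A : (ZMod 3)⟦X⟧) {m : ℕ} (hm : ¬ 3 ∣ m) : coeff m (A ^ 3) = 0 := by
  obtain ⟨m, rfl⟩ := Nat.exists_eq_add_one_of_ne_zero (show m ≠ 0 by rintro rfl; simp at hm)
  have h : d⁄dX (ZMod 3) (A ^ 3) = 0 := by
    rw [derivative_pow]
    have : ((3 : ℕ) : (ZMod 3)⟦X⟧) = 0 := by
      rw [← map_natCast (C (R := ZMod 3))]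
      exact (congrArg _ (by decide)).trans (map_zero _)
    rw [this, zero_mul, zero_mul]
  have h' := congrArg (coeff m) h
  rw [coeff_derivative, map_zero] at h'
  refine (mul_eq_zero.1 h').resolve_right fun h0 => hm ?_
  rw [← ZMod.natCast_eq_zero_iff]
  exact_mod_cast h0

lemma coeff_overGenFun_sq (n : ℕ) : coeff (3 * n + 2) (overGenFun (ZMod 3) ^ 2) = 0 := by
  set A := overGenFun (ZMod 3) with hA
  set N := 3 * n + 2 with hN
  set Θ : (ZMod 3)⟦X⟧ := ∑ j ∈ Finset.range (N + 1), thetaCoeff _ j * X ^ (j ^ 2) with hΘ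
  have h := X_pow_dvd_iff.1 ((X_pow_dvd_overGenFun_mul_theta (ZMod 3) N).mul_left (A ^ 2)) N
    (Nat.lt_succ_self _)
  have e : A ^ 2 * (A * Θ - 1) = A ^ 3 * Θ - A ^ 2 := by ring
  rw [e, map_sub, sub_eq_zero] at h
  rw [← h, hΘ, Finset.mul_sum, map_sum]
  refine Finset.sum_eq_zero fun j _ => ?_
  rw [← map_thetaCoeff (C (R := ZMod 3)), mul_left_comm, coeff_C_mul, coeff_mul_X_pow']
  split
  · rw [coeff_cube_eq_zero, mul_zero]
    intro hd
    have := sq_mod_three_ne_two j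
    omega
  · simp

/-- Overpartitions of `n` are partitions of `n` with a chosen set of part sizes. -/
def overpartitionEquiv (n : ℕ) : {x : Multiset ℕ × Finset ℕ // IsOverpartition x ∧ x.1.sum = n} ≃
      Σ p : n.Partition, {s : Finset ℕ // s ∈ p.parts.toFinset.powerset} :=
    { toFun := fun x => ⟨⟨x.1.1, fun {i} hi => x.2.1.1 i hi, x.2.2⟩, x.1.2, by
        simpa [Finset.subset_iff] using x.2.1.2⟩
      invFun := fun y => ⟨(y.1.parts, y.2.1), ⟨fun i hi => y.1.parts_pos hi, by
        have := Finset.mem_powerset.1 y.2.2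
        exact fun s hs => Multiset.mem_toFinset.1 (this hs)⟩, y.1.parts_sum⟩
      left_inv := fun _ => rfl
      right_inv := fun _ => rfl }


lemma natCast_card_overpartition (R : Type*) [CommRing R] (n : ℕ) :
    (Nat.card {x : Multiset ℕ × Finset ℕ // IsOverpartition x ∧ x.1.sum = n} : R) =
      coeff n (overGenFun R) := by
  rw [Nat.card_congr (overpartitionEquiv n), Nat.card_eq_fintype_card, Fintype.card_sigma]
  simp [overGenFun, Finsupp.prod]

lemma natCast_card_overpartition_pair (R : Type*) [CommRing R] (n : ℕ) :
    (Nat.card {x : (Multiset ℕ × Finset ℕ) × (Multiset ℕ × Finset ℕ) //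
      IsOverpartition x.1 ∧ IsOverpartition x.2 ∧ x.1.1.sum + x.2.1.sum = n} : R) =
      coeff n (overGenFun R ^ 2) := by
  let O (m : ℕ) := {x : Multiset ℕ × Finset ℕ // IsOverpartition x ∧ x.1.sum = m}
  let e : {x : (Multiset ℕ × Finset ℕ) × (Multiset ℕ × Finset ℕ) //
      IsOverpartition x.1 ∧ IsOverpartition x.2 ∧ x.1.1.sum + x.2.1.sum = n} ≃
      Σ ij : Finset.HasAntidiagonal.antidiagonal n, O ij.1.1 × O ij.1.2 :=
    { toFun := fun x => ⟨⟨(x.1.1.1.sum, x.1.2.1.sum),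
          Finset.HasAntidiagonal.mem_antidiagonal.2 x.2.2.2⟩,
        ⟨x.1.1, x.2.1, rfl⟩, ⟨x.1.2, x.2.2.1, rfl⟩⟩
      invFun := fun y => ⟨(y.2.1.1, y.2.2.1), y.2.1.2.1, y.2.2.2.1, by
        rw [y.2.1.2.2, y.2.2.2.2]; exact Finset.HasAntidiagonal.mem_antidiagonal.1 y.1.2⟩
      left_inv := fun _ => rfl
      right_inv := by
        rintro ⟨⟨⟨i, j⟩, h⟩, ⟨x, hx, hi⟩, ⟨y, hy, hj⟩⟩
        dsimp only at hi hj
        subst hi hj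
        rfl }
  have hfin (m : ℕ) : Finite (O m) := .of_equiv _ (overpartitionEquiv m).symm
  rw [Nat.card_congr e, Nat.card_sigma, pow_two, coeff_mul,
    ← Finset.sum_coe_sort (Finset.HasAntidiagonal.antidiagonal n)]
  push_cast
  refine Finset.sum_congr rfl fun ij _ => ?_
  rw [Nat.card_prod, Nat.cast_mul, natCast_card_overpartition, natCast_card_overpartition]

lemma isOddStaircase_sum {m : Multiset ℕ} (h : IsOddStaircase m) : ∃ k, m.sum = k ^ 2 := by
  obtain ⟨k, rfl⟩ := h
  refine ⟨k, ?_⟩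
  induction k with
  | zero => simp
  | succ k ih =>
    rw [Multiset.range_succ, Multiset.map_cons, Multiset.sum_cons, ih]
    ring

theorem overpartition_pair_structure (n : ℕ) :
    (3 ∣ Nat.card {x : (Multiset ℕ × Multiset ℕ × Multiset ℕ) × (Multiset ℕ × Bool) //
      IsEvenPartition x.1.1 ∧ IsEvenPartition x.1.2.1 ∧ IsEvenPartition x.1.2.2 ∧
      IsOddStaircase x.2.1 ∧ (x.2.2 = true → x.2.1 ≠ 0) ∧
      x.1.1.sum + x.1.2.1.sum + x.1.2.2.sum + x.2.1.sum = 3 * n + 2}) ∧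
    3 ∣ Nat.card {x : (Multiset ℕ × Finset ℕ) × (Multiset ℕ × Finset ℕ) //
      IsOverpartition x.1 ∧ IsOverpartition x.2 ∧ x.1.1.sum + x.2.1.sum = 3 * n + 2} := by
  constructor
  · refine three_dvd_card_of_fixedPointFree
      (fun x => ⟨((x.1.1.2.1, x.1.1.2.2, x.1.1.1), x.1.2), x.2.2.1, x.2.2.2.1, x.2.1,
        x.2.2.2.2.1, x.2.2.2.2.2.1, by have := x.2.2.2.2.2.2; dsimp only; omega⟩)
      (fun _ => rfl) ?_
    rintro ⟨⟨⟨a, b, c⟩, m, s⟩, _, _, _, hm, _, hsum⟩ h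
    simp only [Subtype.mk.injEq, Prod.mk.injEq, and_true] at h
    obtain ⟨rfl, rfl, -⟩ := h
    obtain ⟨k, hk⟩ := isOddStaircase_sum hm
    refine sq_mod_three_ne_two k ?_
    dsimp only at hsum hk
    omega
  · rw [← ZMod.natCast_eq_zero_iff, natCast_card_overpartition_pair, coeff_overGenFun_sq]
end
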